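/- (Derivative formula of the main SPPS theorem.) For every λ = (λ₁,…,λ_d) ∈ ℂ^d, the derivative of u₁ is given by the uniformly convergent series u₁′ = (u₀′/u₀) u₁ + (1/(p u₀)) Σ_{n∈ℕ^d, n≠0} (1/(2|n|−1)!) Σ_{i=1}^d X̃_{2n−δᵢ} · λ₁^{n₁}⋯λ_d^{n_d} on [x₁, x₂], where terms X̃_{2n−δᵢ} with a negative entry are zero. -/

import Mathlib

open Set Filter Topology MeasureTheory in
/-- Fundamental theorem of calculus on a closed interval, one-sided at the end points. -/
lemma hasDerivWithinAt_integral_Icc {f : ℝ → ℂ} {a b c x : ℝ} (hf : ContinuousOn f (Icc a b))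
    (hc : c ∈ Icc a b) (hx : x ∈ Icc a b) :
    HasDerivWithinAt (fun y => ∫ t in c..y, f t) (f x) (Icc a b) x := by
  have : Fact (x ∈ Icc a b) := ⟨hx⟩
  exact intervalIntegral.integral_hasDerivWithinAt_right
    (hf.mono (uIcc_subset_Icc hc hx)).intervalIntegrable
    (hf.stronglyMeasurableAtFilter_nhdsWithin measurableSet_Icc x) (hf x hx)

open Set MeasureTheory in
lemma norm_succ_mul_integral_le {f : ℝ → ℂ} {C a x : ℝ} {k : ℕ}
    (h : ∀ t ∈ uIoc a x, ‖f t‖ ≤ C * |t - a| ^ k) :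
    ‖((k + 1 : ℕ) : ℂ) * ∫ t in a..x, f t‖ ≤ C * |x - a| ^ (k + 1) := by
  have hcont : Continuous fun t : ℝ => C * |t - a| ^ k := by fun_prop
  have key : ‖∫ t in a..x, f t‖ ≤ C * (|x - a| ^ (k + 1) / (k + 1)) := by
    calc ‖∫ t in a..x, f t‖ ≤ ∫ t in uIoc a x, ‖f t‖ :=
          intervalIntegral.norm_integral_le_integral_norm_uIoc
      _ ≤ ∫ t in uIoc a x, C * |t - a| ^ k := by
          refine integral_mono_of_nonneg (Filter.Eventually.of_forall fun _ => norm_nonneg _)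
            (intervalIntegrable_iff.mp (hcont.intervalIntegrable a x)) ?_
          exact (ae_restrict_iff' measurableSet_uIoc).mpr (Filter.Eventually.of_forall h)
      _ = C * (|x - a| ^ (k + 1) / (k + 1)) := by
          rw [integral_const_mul, integral_pow_abs_sub_uIoc]
  rw [norm_mul, Complex.norm_natCast]
  calc ((k + 1 : ℕ) : ℝ) * ‖∫ t in a..x, f t‖
      ≤ ((k + 1 : ℕ) : ℝ) * (C * (|x - a| ^ (k + 1) / (k + 1))) := by gcongr
    _ = C * |x - a| ^ (k + 1) := by
        push_cast
        field_simp

lemma summable_prod_apply_of_nonneg {ι : Type*} [Fintype ι] [DecidableEq ι] {f : ℕ → ℝ}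
    (hf : Summable f) (h0 : ∀ k, 0 ≤ f k) : Summable fun n : ι → ℕ => ∏ i, f (n i) := by
  refine summable_of_sum_le (c := ∏ _i : ι, ∑' k, f k)
    (fun n => Finset.prod_nonneg fun i _ => h0 _) fun s => ?_
  calc ∑ n ∈ s, ∏ i, f (n i)
      ≤ ∑ n ∈ Fintype.piFinset fun i => s.image fun n => n i, ∏ i, f (n i) := by
        refine Finset.sum_le_sum_of_subset_of_nonneg (fun n hn => ?_)
          fun n _ _ => Finset.prod_nonneg fun i _ => h0 _
        exact Fintype.mem_piFinset.mpr fun i => Finset.mem_image_of_mem _ hn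
    _ = ∏ i, ∑ k ∈ s.image fun n => n i, f k := (Finset.prod_univ_sum _ _).symm
    _ ≤ ∏ _i : ι, ∑' k, f k :=
        Finset.prod_le_prod (fun i _ => Finset.sum_nonneg fun k _ => h0 k)
          fun i _ => hf.sum_le_tsum _ fun k _ => h0 k

lemma eq_add_single_of_ne_zero {ι : Type*} [DecidableEq ι] {n : ι → ℕ} {i : ι} (h : n i ≠ 0) :
    ∃ m : ι → ℕ, n = m + Pi.single i 1 := by
  refine ⟨n - Pi.single i 1, ?_⟩
  ext k
  rcases eq_or_ne k i with rfl | hk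
  · simp
    omega
  · simp [hk]

lemma sum_add_single {ι : Type*} [Fintype ι] [DecidableEq ι] (m : ι → ℕ) (i : ι) :
    ∑ k, (m + Pi.single i 1 : ι → ℕ) k = ∑ k, m k + 1 := by
  simp [Finset.sum_add_distrib]

/-- The recursion for the formal powers, indexed by `ℕ^d`: `E n` plays the role of `X̃_{2n}` and
`O n i` that of `X̃_{2n-δᵢ}`. -/
structure IsFormalPowers {d : ℕ} (a b c : ℝ) (w : ℝ → ℂ) (s : Fin d → ℝ → ℂ)
    (E : (Fin d → ℕ) → ℝ → ℂ) (O : (Fin d → ℕ) → Fin d → ℝ → ℂ) : Prop where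
  even_zero : ∀ x, E 0 x = 1
  odd_of_eq_zero : ∀ n i, n i = 0 → ∀ x, O n i x = 0
  odd_add_single : ∀ n i, ∀ x ∈ Set.Icc a b, O (n + Pi.single i 1) i x =
    ((2 * ∑ k, n k + 1 : ℕ) : ℂ) * ∫ t in c..x, s i t * E n t
  even_of_ne_zero : ∀ n, n ≠ 0 → ∀ x ∈ Set.Icc a b, E n x =
    ((2 * ∑ k, n k : ℕ) : ℂ) * ∫ t in c..x, w t * ∑ i, O n i t

namespace IsFormalPowers

open Set

variable {d : ℕ} {a b c : ℝ} {w : ℝ → ℂ} {s : Fin d → ℝ → ℂ} {E : (Fin d → ℕ) → ℝ → ℂ}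
  {O : (Fin d → ℕ) → Fin d → ℝ → ℂ} {M : ℝ}

lemma odd_bound (H : IsFormalPowers a b c w s E O) (hc : c ∈ Icc a b)
    (hs : ∀ i, ContinuousOn (s i) (Icc a b)) (hsM : ∀ i, ∀ x ∈ Icc a b, ‖s i x‖ ≤ M) {N : ℕ}
    (hE : ∀ m : Fin d → ℕ, ∑ k, m k = N → ContinuousOn (E m) (Icc a b) ∧
      ∀ x ∈ Icc a b, ‖E m x‖ ≤ d ^ N * M ^ (2 * N) * |x - c| ^ (2 * N))
    (hM : 0 ≤ M) (n : Fin d → ℕ) (hn : ∑ k, n k = N + 1) (i : Fin d) :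
    ContinuousOn (O n i) (Icc a b) ∧
      ∀ x ∈ Icc a b, ‖O n i x‖ ≤ d ^ N * M ^ (2 * N + 1) * |x - c| ^ (2 * N + 1) := by
  by_cases hni : n i = 0
  · rw [funext (H.odd_of_eq_zero n i hni)]
    refine ⟨continuousOn_const, fun x _ => ?_⟩
    rw [norm_zero]
    positivity
  · obtain ⟨m, rfl⟩ := eq_add_single_of_ne_zero hni
    rw [sum_add_single, add_left_inj] at hn
    obtain ⟨hcont, hbound⟩ := hE m hn
    refine ⟨?_, fun x hx => ?_⟩
    · refine ContinuousOn.congr ?_ (H.odd_add_single m i)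
      exact continuousOn_const.mul fun x hx =>
        (hasDerivWithinAt_integral_Icc ((hs i).mul hcont) hc hx).continuousWithinAt
    · rw [H.odd_add_single m i x hx, hn]
      refine norm_succ_mul_integral_le fun t ht => ?_
      have ht' := uIcc_subset_Icc hc hx (uIoc_subset_uIcc ht)
      calc ‖s i t * E m t‖ ≤ M * (d ^ N * M ^ (2 * N) * |t - c| ^ (2 * N)) := by
            rw [norm_mul]
            exact mul_le_mul (hsM i t ht') (hbound t ht') (norm_nonneg _) hM
        _ = d ^ N * M ^ (2 * N + 1) * |t - c| ^ (2 * N) := by ring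

lemma even_bound (H : IsFormalPowers a b c w s E O) (hc : c ∈ Icc a b)
    (hw : ContinuousOn w (Icc a b)) (hs : ∀ i, ContinuousOn (s i) (Icc a b))
    (hwM : ∀ x ∈ Icc a b, ‖w x‖ ≤ M) (hsM : ∀ i, ∀ x ∈ Icc a b, ‖s i x‖ ≤ M) (hM : 0 ≤ M)
    (N : ℕ) : ∀ n : Fin d → ℕ, ∑ k, n k = N → ContinuousOn (E n) (Icc a b) ∧
      ∀ x ∈ Icc a b, ‖E n x‖ ≤ d ^ N * M ^ (2 * N) * |x - c| ^ (2 * N) := by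
  induction N with
  | zero =>
    intro n hn
    obtain rfl : n = 0 := by
      ext k
      exact Finset.sum_eq_zero_iff.mp hn k (Finset.mem_univ k)
    rw [funext H.even_zero]
    exact ⟨continuousOn_const, fun x _ => by simp⟩
  | succ N ih =>
    intro n hn
    have hn0 : n ≠ 0 := by
      rintro rfl
      simp at hn
    have hodd := H.odd_bound hc hs hsM ih hM n hn
    have hcont : ContinuousOn (fun t => w t * ∑ i, O n i t) (Icc a b) :=
      hw.mul (continuousOn_finsetSum _ fun i _ => (hodd i).1)
    refine ⟨?_, fun x hx => ?_⟩
    · refine ContinuousOn.congr ?_ (H.even_of_ne_zero n hn0)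
      exact continuousOn_const.mul fun x hx =>
        (hasDerivWithinAt_integral_Icc hcont hc hx).continuousWithinAt
    · rw [H.even_of_ne_zero n hn0 x hx, hn]
      refine norm_succ_mul_integral_le (k := 2 * N + 1) fun t ht => ?_
      have ht' := uIcc_subset_Icc hc hx (uIoc_subset_uIcc ht)
      calc ‖w t * ∑ i, O n i t‖
          ≤ M * ∑ _i : Fin d, d ^ N * M ^ (2 * N + 1) * |t - c| ^ (2 * N + 1) := by
            rw [norm_mul]
            exact mul_le_mul (hwM t ht') (norm_sum_le_of_le _ fun i _ => (hodd i).2 t ht')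
              (norm_nonneg _) hM
        _ = d ^ (N + 1) * M ^ (2 * (N + 1)) * |t - c| ^ (2 * N + 1) := by
            simp only [Finset.sum_const, Finset.card_univ, Fintype.card_fin, nsmul_eq_mul]
            ring

lemma norm_term_le (H : IsFormalPowers a b c w s E O) (hc : c ∈ Icc a b)
    (hw : ContinuousOn w (Icc a b)) (hs : ∀ i, ContinuousOn (s i) (Icc a b))
    (hwM : ∀ x ∈ Icc a b, ‖w x‖ ≤ M) (hsM : ∀ i, ∀ x ∈ Icc a b, ‖s i x‖ ≤ M) (hM : 0 ≤ M)
    {T Λ : ℝ} (hT : 1 ≤ T) (hMT : M * (b - a) ≤ T) {lam : Fin d → ℂ} (hlam : ∀ i, ‖lam i‖ ≤ Λ)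
    (hΛ : 0 ≤ Λ) {n : Fin d → ℕ} (hn : n ≠ 0) :
    (∀ i, ContinuousOn (O n i) (Icc a b)) ∧ ∀ x ∈ Icc a b,
      ‖(1 / (Nat.factorial (2 * (∑ i, n i) - 1) : ℂ)) * (∑ i, O n i x) * ∏ i, lam i ^ n i‖ ≤
        ∏ i, (d * T ^ 2 * Λ) ^ n i / (n i).factorial := by
  obtain ⟨N, hN⟩ : ∃ N, ∑ k, n k = N + 1 := by
    refine Nat.exists_eq_add_one_of_ne_zero fun h => hn ?_
    ext k
    exact Finset.sum_eq_zero_iff.mp h k (Finset.mem_univ k)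
  have hodd := H.odd_bound hc hs hsM (H.even_bound hc hw hs hwM hsM hM N) hM n hN
  refine ⟨fun i => (hodd i).1, fun x hx => ?_⟩
  have hxc : M * |x - c| ≤ T := by
    have : |x - c| ≤ b - a := abs_le.mpr ⟨by linarith [hx.1, hc.2], by linarith [hx.2, hc.1]⟩
    exact (mul_le_mul_of_nonneg_left this hM).trans hMT
  have hO : ‖∑ i, O n i x‖ ≤ d ^ (N + 1) * T ^ (2 * (N + 1)) := by
    calc ‖∑ i, O n i x‖
        ≤ ∑ _i : Fin d, d ^ N * M ^ (2 * N + 1) * |x - c| ^ (2 * N + 1) :=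
          norm_sum_le_of_le _ fun i _ => (hodd i).2 x hx
      _ = d ^ (N + 1) * (M * |x - c|) ^ (2 * N + 1) := by
          simp only [Finset.sum_const, Finset.card_univ, Fintype.card_fin, nsmul_eq_mul]
          ring
      _ ≤ d ^ (N + 1) * T ^ (2 * N + 1) := by gcongr
      _ ≤ d ^ (N + 1) * T ^ (2 * (N + 1)) :=
          mul_le_mul_of_nonneg_left (pow_le_pow_right₀ hT (by omega)) (by positivity)
  have hprod : ‖∏ i, lam i ^ n i‖ ≤ Λ ^ (N + 1) := by
    rw [norm_prod, ← hN, ← Finset.prod_pow_eq_pow_sum]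
    refine Finset.prod_le_prod (fun i _ => norm_nonneg _) fun i _ => ?_
    rw [norm_pow]
    exact pow_le_pow_left₀ (norm_nonneg _) (hlam i) _
  have hfac_pos : 0 < ∏ i, ((n i).factorial : ℝ) := Finset.prod_pos fun i _ => by positivity
  have hfac : 1 / ((2 * (N + 1) - 1).factorial : ℝ) ≤ 1 / ∏ i, ((n i).factorial : ℝ) := by
    have : ∏ i, (n i).factorial ≤ (2 * (∑ i, n i) - 1).factorial :=
      (Nat.le_of_dvd (Nat.factorial_pos _)
        (Nat.prod_factorial_dvd_factorial_sum Finset.univ n)).trans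
        (Nat.factorial_le (by omega))
    rw [hN] at this
    exact one_div_le_one_div_of_le hfac_pos (by exact_mod_cast this)
  rw [norm_mul, norm_mul, norm_div, norm_one, Complex.norm_natCast, hN]
  generalize (2 * (N + 1) - 1).factorial = F at hfac ⊢
  calc 1 / (F : ℝ) * ‖∑ i, O n i x‖ * ‖∏ i, lam i ^ n i‖
      ≤ 1 / (∏ i, ((n i).factorial : ℝ)) * (d ^ (N + 1) * T ^ (2 * (N + 1))) * Λ ^ (N + 1) := by
        gcongr
    _ = (d * T ^ 2 * Λ) ^ (N + 1) / ∏ i, ((n i).factorial : ℝ) := by ring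
    _ = ∏ i, (d * T ^ 2 * Λ) ^ n i / (n i).factorial := by
        rw [Finset.prod_div_distrib, Finset.prod_pow_eq_pow_sum, hN]

/-- The terms of the derivative series are continuous and dominated by a summable family. -/
lemma exists_summable_bound (H : IsFormalPowers a b c w s E O) (hc : c ∈ Icc a b)
    (hw : ContinuousOn w (Icc a b)) (hs : ∀ i, ContinuousOn (s i) (Icc a b)) (lam : Fin d → ℂ) :
    ∃ B : (Fin d → ℕ) → ℝ, Summable B ∧ ∀ n, n ≠ 0 →
      (∀ i, ContinuousOn (O n i) (Icc a b)) ∧ ∀ x ∈ Icc a b,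
        ‖(1 / (Nat.factorial (2 * (∑ i, n i) - 1) : ℂ)) * (∑ i, O n i x) *
          ∏ i, lam i ^ n i‖ ≤ B n := by
  obtain ⟨Mw, hMw⟩ := isCompact_Icc.exists_bound_of_continuousOn hw
  choose Ms hMs using fun i => isCompact_Icc.exists_bound_of_continuousOn (hs i)
  have hMw0 : 0 ≤ Mw := (norm_nonneg _).trans (hMw c hc)
  have hMs0 : ∀ i, 0 ≤ Ms i := fun i => (norm_nonneg _).trans (hMs i c hc)
  have hsum : 0 ≤ ∑ i, Ms i := Finset.sum_nonneg fun i _ => hMs0 i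
  have hΛ : 0 ≤ ∑ i, ‖lam i‖ := Finset.sum_nonneg fun i _ => norm_nonneg _
  have hM : 0 ≤ Mw + ∑ i, Ms i := add_nonneg hMw0 hsum
  refine ⟨_, summable_prod_apply_of_nonneg (Real.summable_pow_div_factorial _)
    (fun k => by positivity), fun n hn => H.norm_term_le hc hw hs
      (fun x hx => (hMw x hx).trans (le_add_of_nonneg_right hsum))
      (fun i x hx => (hMs i x hx).trans ?_) hM
      (T := 1 + (Mw + ∑ i, Ms i) * (b - a)) ?_ (by linarith)
      (fun i => Finset.single_le_sum (fun i _ => norm_nonneg (lam i)) (Finset.mem_univ i)) hΛ hn⟩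
  · exact le_add_of_nonneg_of_le hMw0
      (Finset.single_le_sum (fun i _ => hMs0 i) (Finset.mem_univ i))
  · exact le_add_of_nonneg_right (mul_nonneg hM (sub_nonneg.mpr (hc.1.trans hc.2)))

end IsFormalPowers

open Set Filter Topology MeasureTheory in
/-- A uniformly dominated series of continuous functions may be integrated term by term. -/
lemma hasSum_integral_of_continuousOn_of_bound {ι : Type*} [Countable ι] {f : ι → ℝ → ℂ}
    {B : ι → ℝ} {a b c x : ℝ} (hB : Summable B) (hf : ∀ n, ContinuousOn (f n) (Icc a b))
    (hfB : ∀ n, ∀ x ∈ Icc a b, ‖f n x‖ ≤ B n) (hc : c ∈ Icc a b) (hx : x ∈ Icc a b) :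
    HasSum (fun n => ∫ t in c..x, f n t) (∫ t in c..x, ∑' n, f n t) := by
  have hsub : uIoc c x ⊆ Icc a b := uIoc_subset_uIcc.trans (uIcc_subset_Icc hc hx)
  refine intervalIntegral.hasSum_integral_of_dominated_convergence (fun n _ => B n)
    (fun n => ((hf n).mono hsub).aestronglyMeasurable measurableSet_uIoc)
    (fun n => Eventually.of_forall fun t ht => hfB n t (hsub ht))
    (Eventually.of_forall fun _ _ => hB) intervalIntegrable_const
    (Eventually.of_forall fun t ht => ?_)
  exact (Summable.of_norm_bounded hB fun n => hfB n t (hsub ht)).hasSum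


/-- **Derivative formula of the main SPPS theorem.**  With the SPPS formal powers `X̃_j`
(here `Xt j`) defined by the recursion in the hypotheses and
`u₁(x) = u₀(x) Σ_{n∈ℕ^d} (1/(2|n|)!) X̃_{2n}(x) λ₁^{n₁}⋯λ_d^{n_d}`, the derivative of `u₁`
is given by the uniformly convergent series
`u₁′ = (u₀′/u₀) u₁ + (1/(p u₀)) Σ_{n≠0} (1/(2|n|−1)!) Σᵢ X̃_{2n−δᵢ} λ₁^{n₁}⋯λ_d^{n_d}`
on `[x₁, x₂]` (derivatives within `[x₁, x₂]`; terms `X̃_{2n−δᵢ}` with a negative entry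
vanish by the recursion). -/
theorem SPPS_derivative_formula
    (d : ℕ) (hd : 1 ≤ d)
    (x₁ x₂ x₀ : ℝ) (hx : x₁ < x₂) (hx₀ : x₀ ∈ Set.Icc x₁ x₂)
    (p q u₀ : ℝ → ℂ) (r : Fin d → ℝ → ℂ)
    (hp : ContDiffOn ℝ 1 p (Set.Icc x₁ x₂))
    (hq : ContinuousOn q (Set.Icc x₁ x₂))
    (hr : ∀ i, ContinuousOn (r i) (Set.Icc x₁ x₂))
    (hpne : ∀ x ∈ Set.Icc x₁ x₂, p x ≠ 0)
    (hu₀ : ContDiffOn ℝ 2 u₀ (Set.Icc x₁ x₂))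
    (hu₀ne : ∀ x ∈ Set.Icc x₁ x₂, u₀ x ≠ 0)
    (hu₀sol : ∀ x ∈ Set.Icc x₁ x₂,
      derivWithin (fun t => p t * derivWithin u₀ (Set.Icc x₁ x₂) t) (Set.Icc x₁ x₂) x
        + q x * u₀ x = 0)
    (Xt : (Fin d → ℤ) → ℝ → ℂ)
    (hXt0 : ∀ x, Xt 0 x = 1)
    (hXtneg : ∀ j : Fin d → ℤ, (∃ i, j i < 0) → ∀ x, Xt j x = 0)
    (hXtodd : ∀ j : Fin d → ℤ, (∀ i, 0 ≤ j i) →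
      (∀ i i', Odd (j i) → Odd (j i') → i = i') →
      ∀ i, Odd (j i) → ∀ x ∈ Set.Icc x₁ x₂,
        Xt j x = (((∑ i', j i') : ℤ) : ℂ) *
          ∫ t in x₀..x, r i t * u₀ t ^ 2 * Xt (j - Pi.single i 1) t)
    (hXteven : ∀ j : Fin d → ℤ, (∀ i, 0 ≤ j i) →
      (∀ i i', Odd (j i) → Odd (j i') → i = i') →
      Even (∑ i, j i) → j ≠ 0 → ∀ x ∈ Set.Icc x₁ x₂,
        Xt j x = (((∑ i, j i) : ℤ) : ℂ) *
          ∫ t in x₀..x, (1 / (p t * u₀ t ^ 2)) * ∑ i, Xt (j - Pi.single i 1) t)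
    (lam : Fin d → ℂ)
    (u₁ : ℝ → ℂ)
    (hu₁def : ∀ x, u₁ x = u₀ x * ∑' n : Fin d → ℕ,
      (1 / (Nat.factorial (2 * ∑ i, n i) : ℂ)) *
        Xt (fun i => (2 * n i : ℤ)) x * ∏ i, lam i ^ n i)
    (g : {n : Fin d → ℕ // n ≠ 0} → ℝ → ℂ)
    (hg : ∀ n x, g n x = (1 / (Nat.factorial (2 * (∑ i, n.1 i) - 1) : ℂ)) *
      (∑ i, Xt ((fun i' => (2 * n.1 i' : ℤ)) - Pi.single i 1) x) * ∏ i, lam i ^ n.1 i) :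
    TendstoUniformlyOn
      (fun (s : Finset {n : Fin d → ℕ // n ≠ 0}) x => ∑ n ∈ s, g n x)
      (fun x => ∑' n : {n : Fin d → ℕ // n ≠ 0}, g n x) Filter.atTop (Set.Icc x₁ x₂) ∧
    ∀ x ∈ Set.Icc x₁ x₂,
      derivWithin u₁ (Set.Icc x₁ x₂) x
        = derivWithin u₀ (Set.Icc x₁ x₂) x / u₀ x * u₁ x
          + (1 / (p x * u₀ x)) * ∑' n : {n : Fin d → ℕ // n ≠ 0}, g n x := by
  
  set I := Set.Icc x₁ x₂ with hI
  set w : ℝ → ℂ := fun t => 1 / (p t * u₀ t ^ 2) with hw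
  set E : (Fin d → ℕ) → ℝ → ℂ := fun n => Xt fun i => (2 * n i : ℤ) with hE
  set O : (Fin d → ℕ) → Fin d → ℝ → ℂ := fun n i =>
    Xt ((fun i' => (2 * n i' : ℤ)) - Pi.single i 1) with hO
  have hwcont : ContinuousOn w I :=
    continuousOn_const.div (hp.continuousOn.mul (hu₀.continuousOn.pow 2)) fun x hx =>
      mul_ne_zero (hpne x hx) (pow_ne_zero 2 (hu₀ne x hx))
  have hscont : ∀ i, ContinuousOn (fun t => r i t * u₀ t ^ 2) I := fun i =>
    (hr i).mul (hu₀.continuousOn.pow 2)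
  have H : IsFormalPowers x₁ x₂ x₀ w (fun i t => r i t * u₀ t ^ 2) E O := by
    refine ⟨fun x => ?_, fun n i hni x => ?_, fun n i x hx => ?_, fun n hn x hx => ?_⟩
    · rw [← hXt0 x]
      simp only [hE]
      congr 1
    · refine hXtneg _ ⟨i, ?_⟩ x
      simp [hni]
    · have hsingle : ∀ k, (2 * ((n + Pi.single i 1 : Fin d → ℕ) k : ℤ)) -
          (Pi.single i 1 : Fin d → ℤ) k = 2 * n k + (Pi.single i 1 : Fin d → ℤ) k := by
        intro k
        rcases eq_or_ne k i with rfl | hk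
        · simp
          ring
        · simp [hk]
      have hidx : (fun k => 2 * ((n + Pi.single i 1 : Fin d → ℕ) k : ℤ)) - Pi.single i 1 =
          (fun k => (2 * n k : ℤ)) + Pi.single i 1 := funext hsingle
      have hodd_iff : ∀ k, Odd (((fun k => (2 * n k : ℤ)) + Pi.single i 1 : Fin d → ℤ) k) ↔
          k = i := by
        intro k
        rcases eq_or_ne k i with rfl | hk
        · simp
        · simp [hk]
      simp only [hO, hidx]
      rw [hXtodd _ (fun k => ?_) (fun k k' hk hk' => ?_) i ((hodd_iff i).mpr rfl) x hx]
      · simp [hE, Finset.sum_add_distrib, Finset.mul_sum]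
      · rcases eq_or_ne k i with rfl | hk
        · simp
          omega
        · simp [hk]
      · rw [(hodd_iff k).mp hk, (hodd_iff k').mp hk']
    · simp only [hE]
      rw [hXteven _ (fun k => by positivity) (fun k k' hk => ?_) ?_ ?_ x hx]
      · simp [hO, hw, Finset.mul_sum]
      · rw [← Finset.mul_sum]
        exact even_two_mul _
      · intro h
        refine hn (funext fun k => ?_)
        simpa using congrFun h k
      · exact absurd hk (by simp)
  obtain ⟨B, hB, hbound⟩ := H.exists_summable_bound hx₀ hwcont hscont lam
  have hB' : Summable fun n : {n : Fin d → ℕ // n ≠ 0} => B n := hB.subtype _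
  have hgB : ∀ n, ∀ x ∈ I, ‖g n x‖ ≤ B n := fun n x hxI => by
    rw [hg]
    exact (hbound n n.2).2 x hxI
  have hgcont : ∀ n, ContinuousOn (g n) I := fun n => by
    rw [funext (hg n)]
    exact (continuousOn_const.mul
      (continuousOn_finsetSum _ fun i _ => (hbound n n.2).1 i)).mul continuousOn_const
  have hunif := tendstoUniformlyOn_tsum hB' hgB
  refine ⟨hunif, fun x hxI => ?_⟩
  have hGcont : ContinuousOn (fun x => ∑' n, g n x) I := continuousOn_tsum hgcont hB' hgB
  have hwG : ContinuousOn (fun t => w t * ∑' n, g n t) I := hwcont.mul hGcont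
  obtain ⟨Mw, hMw⟩ := isCompact_Icc.exists_bound_of_continuousOn hwcont
  have hseries : ∀ y ∈ I, ∑' n : Fin d → ℕ,
      (1 / (Nat.factorial (2 * ∑ i, n i) : ℂ)) * E n y * ∏ i, lam i ^ n i =
        1 + ∫ t in x₀..y, w t * ∑' n, g n t := by
    intro y hy
    have hsum := hasSum_integral_of_continuousOn_of_bound (hB'.mul_left Mw)
      (fun n => hwcont.mul (hgcont n)) (fun n t ht => by
        rw [Pi.mul_apply, norm_mul]
        exact mul_le_mul (hMw t ht) (hgB n t ht) (norm_nonneg _)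
          ((norm_nonneg _).trans (hMw t ht))) hx₀ hy
    simp only [Pi.mul_apply, tsum_mul_left] at hsum
    have hterm : ∀ n : {n : Fin d → ℕ // n ≠ 0}, ∫ t in x₀..y, w t * g n t =
        (1 / (Nat.factorial (2 * ∑ i, n.1 i) : ℂ)) * E n y * ∏ i, lam i ^ n.1 i := by
      rintro ⟨n, hn⟩
      have hN : ∑ k, n k ≠ 0 := fun h => hn (funext fun k =>
        Finset.sum_eq_zero_iff.mp h k (Finset.mem_univ k))
      have hfac := Nat.mul_factorial_pred (n := 2 * ∑ k, n k) (by omega)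
      have hint : ∀ t, w t * g ⟨n, hn⟩ t =
          ((1 / (Nat.factorial (2 * (∑ i, n i) - 1) : ℂ)) * ∏ i, lam i ^ n i) *
            (w t * ∑ i, O n i t) := fun t => by
        rw [hg]
        ring
      simp only [hint]
      rw [intervalIntegral.integral_const_mul, H.even_of_ne_zero n hn y hy, ← hfac,
        Nat.cast_mul]
      have h1 : ((2 * ∑ k, n k : ℕ) : ℂ) ≠ 0 := by
        exact_mod_cast (by omega : 2 * ∑ k, n k ≠ 0)
      have h2 : (((2 * ∑ k, n k) - 1).factorial : ℂ) ≠ 0 := by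
        exact_mod_cast Nat.factorial_ne_zero _
      field_simp
    simp only [hterm] at hsum
    have hzero : HasSum (fun n : ({0} : Set (Fin d → ℕ)) =>
        (1 / (Nat.factorial (2 * ∑ i, n.1 i) : ℂ)) * E n y * ∏ i, lam i ^ n.1 i) 1 := by
      simpa [H.even_zero] using hasSum_unique fun n : ({0} : Set (Fin d → ℕ)) =>
        (1 / (Nat.factorial (2 * ∑ i, n.1 i) : ℂ)) * E n y * ∏ i, lam i ^ n.1 i
    exact (hzero.add_compl (s := {0}) (f := fun n : Fin d → ℕ =>
      (1 / (Nat.factorial (2 * ∑ i, n i) : ℂ)) * E n y * ∏ i, lam i ^ n i) hsum).tsum_eq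
  have hu₁ : ∀ y ∈ I, u₁ y = u₀ y * (1 + ∫ t in x₀..y, w t * ∑' n, g n t) := fun y hy => by
    rw [hu₁def, ← hseries y hy]
  have hu₀' : HasDerivWithinAt u₀ (derivWithin u₀ I x) I x :=
    (hu₀.differentiableOn (by norm_num) x hxI).hasDerivWithinAt
  have hderiv := (hu₀'.mul ((hasDerivWithinAt_integral_Icc hwG hx₀ hxI).const_add 1)).congr
    hu₁ (hu₁ x hxI)
  rw [hderiv.derivWithin (uniqueDiffOn_Icc hx x hxI), hu₁ x hxI]
  have h1 := hu₀ne x hxI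
  have h2 := hpne x hxI
  simp only [hw]
  field_simp
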